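/- arXiv:math/0304363 — 2 statements merged into one kernel-verified Lean document; each statement's English description precedes it below -/
import Mathlib

section
/- Let m be a natural number and let λ : Fin (2m) → ℕ be monotone such that every even natural number occurs an even number of times among the values of λ (counted with multiplicity). Then the map λ̄ : Fin (2m) → ℕ defined by λ̄ i = λ i + i is strictly increasing and exactly m of its values are even (hence exactly m of its values are odd). (This is the paper's claim, in the type D construction of u-symbols, that the list η* of even parts of λ̄ has exactly m entries.) -/
/-- The multiset of values of a function on `Fin k`. -/
def mvals {k : ℕ} (f : Fin k → ℕ) : Multiset ℕ :=
  Multiset.map f Finset.univ.val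

/-- An alternating sum over an order-connected set of naturals of even cardinality vanishes. -/
theorem sum_neg_one_pow_eq_zero_of_ordConnected {s : Finset ℕ}
    (hs : (s : Set ℕ).OrdConnected) (hcard : Even s.card) :
    ∑ i ∈ s, (-1 : ℤ) ^ i = 0 := by
  rcases s.eq_empty_or_nonempty with rfl | hne
  · simp
  have hIco : s = Finset.Ico (s.min' hne) (s.max' hne + 1) := by
    ext x
    rw [Finset.mem_Ico, Nat.lt_succ_iff]
    exact ⟨fun hx => ⟨s.min'_le x hx, s.le_max' x hx⟩,
      fun hx => hs.out (s.min'_mem hne) (s.max'_mem hne) hx⟩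
  generalize s.min' hne = a at hIco
  generalize s.max' hne + 1 = b at hIco
  subst hIco
  rw [Nat.card_Ico] at hcard
  rw [Finset.sum_Ico_eq_sum_range]
  simp only [pow_add]
  rw [← Finset.mul_sum, neg_one_geom_sum, if_pos hcard, mul_zero]

/-- The alternating sum over a fiber of even cardinality of a monotone map vanishes. -/
theorem Monotone.sum_fiber_neg_one_pow_eq_zero {k : ℕ} {f : Fin k → ℕ} (hf : Monotone f) {n : ℕ}
    (hcard : Even (Finset.univ.filter fun i => f i = n).card) :
    ∑ i with f i = n, (-1 : ℤ) ^ (i : ℕ) = 0 := by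
  rw [← Finset.card_map Fin.valEmbedding] at hcard
  have h := sum_neg_one_pow_eq_zero_of_ordConnected ?_ hcard
  · simpa only [Finset.sum_map, Fin.valEmbedding_apply] using h
  refine ⟨fun x hx y hy z hz => ?_⟩
  simp only [Finset.coe_map, Finset.coe_filter, Finset.mem_univ, true_and, Set.mem_image,
    Set.mem_ofPred_eq, Fin.valEmbedding_apply] at hx hy ⊢
  obtain ⟨i, hi, rfl⟩ := hx
  obtain ⟨j, hj, rfl⟩ := hy
  refine ⟨⟨z, hz.2.trans_lt j.isLt⟩, le_antisymm ?_ ?_, rfl⟩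
  · exact hj ▸ hf (Fin.le_def.2 hz.2)
  · exact hi ▸ hf (Fin.le_def.2 hz.1)

theorem count_mvals {k : ℕ} (f : Fin k → ℕ) (n : ℕ) :
    (mvals f).count n = (Finset.univ.filter fun i => f i = n).card := by
  simp only [mvals, Multiset.count_map, Finset.card_def, Finset.filter_val, eq_comm]

/-- If every even value of a monotone map is attained an even number of times, the alternating
sum over the indices with even value vanishes. -/
theorem Monotone.sum_even_neg_one_pow_eq_zero {k : ℕ} {f : Fin k → ℕ} (hf : Monotone f)
    (hadm : ∀ n : ℕ, Even n → Even ((mvals f).count n)) :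
    ∑ i with Even (f i), (-1 : ℤ) ^ (i : ℕ) = 0 := by
  rw [← Finset.sum_fiberwise_of_maps_to (t := (Finset.univ.image f).filter Even) (g := f)
    (by simp)]
  refine Finset.sum_eq_zero fun n hn => ?_
  have hn : Even n := (Finset.mem_filter.1 hn).2
  rw [Finset.filter_filter]
  have : (Finset.univ.filter fun i => Even (f i) ∧ f i = n) =
      Finset.univ.filter fun i => f i = n :=
    Finset.filter_congr fun i _ => ⟨And.right, fun h => ⟨h ▸ hn, h⟩⟩
  rw [this]
  exact hf.sum_fiber_neg_one_pow_eq_zero (count_mvals f n ▸ hadm n hn)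

/-- Type D: if λ is a weakly increasing sequence of 2m naturals in which every
even number occurs an even number of times, then λ̄ i = λ i + i is strictly
increasing and exactly m of its values are even. -/
theorem typeD_staircase_even_count (m : ℕ) (lam : Fin (2 * m) → ℕ)
    (hmono : Monotone lam)
    (hadm : ∀ n : ℕ, Even n → Even ((mvals lam).count n)) :
    StrictMono (fun i : Fin (2 * m) => lam i + (i : ℕ)) ∧
      (Finset.univ.filter fun i : Fin (2 * m) => Even (lam i + (i : ℕ))).card = m := by
  refine ⟨fun i j hij => add_lt_add_of_le_of_lt (hmono hij.le) hij, ?_⟩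
  have hzero := hmono.sum_even_neg_one_pow_eq_zero hadm
  have halt : ∑ i : Fin (2 * m), (-1 : ℤ) ^ (i : ℕ) = 0 := by
    rw [Fin.sum_univ_eq_sum_range, neg_one_geom_sum, if_pos (even_two_mul m)]
  have hsum : ∑ i : Fin (2 * m), (-1 : ℤ) ^ (lam i + (i : ℕ)) = 0 := by
    have h : ∀ i : Fin (2 * m), (-1 : ℤ) ^ (lam i + (i : ℕ)) =
        2 * (if Even (lam i) then (-1) ^ (i : ℕ) else 0) - (-1) ^ (i : ℕ) := by
      intro i
      rw [pow_add]
      split_ifs with he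
      · rw [he.neg_one_pow]; ring
      · rw [(Nat.not_even_iff_odd.1 he).neg_one_pow]; ring
    simp_rw [h]
    rw [Finset.sum_sub_distrib, ← Finset.mul_sum, ← Finset.sum_filter, hzero, halt]
    simp
  have hcount : ∀ i : Fin (2 * m), (-1 : ℤ) ^ (lam i + (i : ℕ)) =
      2 * (if Even (lam i + (i : ℕ)) then 1 else 0) - 1 := by
    intro i
    rw [neg_one_pow_eq_ite]
    split_ifs <;> rfl
  simp_rw [hcount] at hsum
  rw [Finset.sum_sub_distrib, ← Finset.mul_sum, Finset.sum_boole] at hsum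
  simp only [Finset.sum_const, Finset.card_univ, Fintype.card_fin, nsmul_eq_mul] at hsum
  push_cast at hsum
  lia
end

section
/- Let m be a natural number and let λ, λ' : Fin (2m+1) → ℕ be monotone and B-admissible. If the u-symbols of λ and λ' coincide, i.e. ξ̄ = ξ̄' and η̄ = η̄', then λ = λ'. (The type-B u-symbol map is injective on B-admissible monotone sequences of length 2m+1.) -/
/-- The first row ξ̄ of a u-symbol: ξ̄ i = ξ i + i where ξ i = (ξ* i − 1)/2. -/
def xiBar {l : ℕ} (xis : Fin l → ℕ) : Fin l → ℕ :=
  fun i => (xis i - 1) / 2 + (i : ℕ)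

/-- The second row η̄ of a u-symbol: η̄ i = η i + i where η i = η* i / 2. -/
def etaBar {l : ℕ} (etas : Fin l → ℕ) : Fin l → ℕ :=
  fun i => etas i / 2 + (i : ℕ)

theorem xiBar_injective_of_odd {l : ℕ} {f g : Fin l → ℕ} (hf : ∀ i, Odd (f i))
    (hg : ∀ i, Odd (g i)) (h : xiBar f = xiBar g) : f = g := by
  funext i
  have hi : (f i - 1) / 2 + (i : ℕ) = (g i - 1) / 2 + (i : ℕ) := congrFun h i
  obtain ⟨a, ha⟩ := hf i
  obtain ⟨b, hb⟩ := hg i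
  omega

theorem etaBar_injective_of_even {l : ℕ} {f g : Fin l → ℕ} (hf : ∀ i, Even (f i))
    (hg : ∀ i, Even (g i)) (h : etaBar f = etaBar g) : f = g := by
  funext i
  have hi : f i / 2 + (i : ℕ) = g i / 2 + (i : ℕ) := congrFun h i
  obtain ⟨a, ha⟩ := hf i
  obtain ⟨b, hb⟩ := hg i
  omega

theorem mem_mvals {k : ℕ} {f : Fin k → ℕ} {n : ℕ} : n ∈ mvals f ↔ n ∈ Set.range f := by
  simp [mvals]

theorem StrictMono.eq_of_mvals_eq {k : ℕ} {f g : Fin k → ℕ} (hf : StrictMono f)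
    (hg : StrictMono g) (h : mvals f = mvals g) : f = g :=
  (hf.range_inj hg).1 (Set.ext fun n => by rw [← mem_mvals, ← mem_mvals, h])

theorem Monotone.strictMono_add_val {k : ℕ} {f : Fin k → ℕ} (hf : Monotone f) :
    StrictMono fun i : Fin k => f i + (i : ℕ) :=
  hf.add_strictMono Fin.val_strictMono

/-- The type-B u-symbol map is injective on B-admissible monotone sequences of
length 2m+1: if the u-symbols of λ and λ' coincide then λ = λ'. -/
theorem usymbol_injective_typeB (m : ℕ) (lam lam' : Fin (2 * m + 1) → ℕ)
    (hmono : Monotone lam) (hmono' : Monotone lam')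
    (hadm : ∀ n : ℕ, Even n → Even ((mvals lam).count n))
    (hadm' : ∀ n : ℕ, Even n → Even ((mvals lam').count n))
    (etas : Fin m → ℕ) (xis : Fin (m + 1) → ℕ)
    (etas' : Fin m → ℕ) (xis' : Fin (m + 1) → ℕ)
    (hetas : StrictMono etas) (hxis : StrictMono xis)
    (hetas' : StrictMono etas') (hxis' : StrictMono xis')
    (hetaseven : ∀ i, Even (etas i)) (hxisodd : ∀ i, Odd (xis i))
    (hetaseven' : ∀ i, Even (etas' i)) (hxisodd' : ∀ i, Odd (xis' i))
    (henum : mvals (fun i : Fin (2 * m + 1) => lam i + (i : ℕ)) = mvals etas + mvals xis)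
    (henum' : mvals (fun i : Fin (2 * m + 1) => lam' i + (i : ℕ)) = mvals etas' + mvals xis')
    (heq : xiBar xis = xiBar xis' ∧ etaBar etas = etaBar etas') :
    lam = lam' := by
  obtain rfl := xiBar_injective_of_odd hxisodd hxisodd' heq.1
  obtain rfl := etaBar_injective_of_even hetaseven hetaseven' heq.2
  have h := hmono.strictMono_add_val.eq_of_mvals_eq hmono'.strictMono_add_val
    (henum.trans henum'.symm)
  funext i
  exact Nat.add_right_cancel (congrFun h i)
end
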